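/- Let b, b' ∈ ℕA and let G, G' be faces of A with G ⊆ G'. Then there exists a finite set C of pairs (a,F), where a ∈ b + ℕG and F is a face of A contained in G, such that (b + ℕG) ∖ (b' + ℕG') = ⋃_{(a,F) ∈ C} (a + ℕF). -/

import Mathlib

open scoped BigOperators

namespace StdPairsPaper

/-- The coercion of a lattice point to a real vector. -/
def toR {d : ℕ} (v : Fin d → ℤ) : Fin d → ℝ := fun i => (v i : ℝ)

/-- The cone of nonnegative real combinations of (the real images of) elements of `S`. -/
def cone {d : ℕ} (S : Set (Fin d → ℤ)) : Set (Fin d → ℝ) :=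
  {x | ∃ (t : Finset (Fin d → ℤ)) (c : (Fin d → ℤ) → ℝ),
    (t : Set (Fin d → ℤ)) ⊆ S ∧ (∀ v, 0 ≤ c v) ∧ x = ∑ v ∈ t, c v • toR v}

/-- `ℕS`, the submonoid of `ℤ^d` generated by `S`. -/
def NSemi {d : ℕ} (S : Set (Fin d → ℤ)) : AddSubmonoid (Fin d → ℤ) :=
  AddSubmonoid.closure S

/-- `ℤS`, the subgroup of `ℤ^d` generated by `S`. -/
def ZGrp {d : ℕ} (S : Set (Fin d → ℤ)) : AddSubgroup (Fin d → ℤ) :=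
  AddSubgroup.closure S

/-- `ℝS`, the real linear span of `S`. -/
def RSpan {d : ℕ} (S : Set (Fin d → ℤ)) : Submodule ℝ (Fin d → ℝ) :=
  Submodule.span ℝ (toR '' S)

/-- `A` is a configuration: a finite set of nonzero lattice points whose `ℤ`-span is `ℤ^d`
and whose nonnegative real cone is strongly convex (contains no line, i.e. is pointed). -/
structure IsConfig {d : ℕ} (A : Set (Fin d → ℤ)) : Prop where
  (finite : A.Finite)
  (nonzero : (0 : Fin d → ℤ) ∉ A)
  (spans : ZGrp A = ⊤)
  (pointed : ∀ x ∈ cone A, -x ∈ cone A → x = 0)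

/-- `F` is a face of the configuration `A`: `F ⊆ A`, the cone over `F` is an extreme
subset (face) of the cone over `A`, and `ℝ_{≥0}F ∩ A = F`. -/
def IsFace {d : ℕ} (A F : Set (Fin d → ℤ)) : Prop :=
  F ⊆ A ∧ IsExtreme ℝ (cone A) (cone F) ∧ cone F ∩ (toR '' A) = toR '' F

/-- The set `a + ℕF`. -/
def cell {d : ℕ} (a : Fin d → ℤ) (F : Set (Fin d → ℤ)) : Set (Fin d → ℤ) :=
  {x | ∃ f ∈ NSemi F, x = a + f}

/-- Two pairs `(a,F)` and `(b,F)` belonging to the same face `F` overlap: `a - b ∈ ℤF`. -/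
def Overlap {d : ℕ} (F : Set (Fin d → ℤ)) (a b : Fin d → ℤ) : Prop :=
  a - b ∈ ZGrp F

/-- The pair `(a,F)` divides the pair `(b,G)`:
there is `c ∈ ℕA` with `a + c + ℕF ⊆ b + ℕG`. -/
def PairDvd {d : ℕ} (A : Set (Fin d → ℤ)) (a : Fin d → ℤ) (F : Set (Fin d → ℤ))
    (b : Fin d → ℤ) (G : Set (Fin d → ℤ)) : Prop :=
  ∃ c ∈ NSemi A, cell (a + c) F ⊆ cell b G

/-- `E` is the exponent set of a monomial ideal of `ℕA`: `E ⊆ ℕA` and `E + ℕA ⊆ E`. -/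
def IsExpSet {d : ℕ} (A E : Set (Fin d → ℤ)) : Prop :=
  E ⊆ (NSemi A : Set (Fin d → ℤ)) ∧ ∀ e ∈ E, ∀ c ∈ NSemi A, e + c ∈ E

/-- The standard monomials of `E`: `ℕA ∖ E`. -/
def stdSet {d : ℕ} (A E : Set (Fin d → ℤ)) : Set (Fin d → ℤ) :=
  (NSemi A : Set (Fin d → ℤ)) \ E

/-- `(a,F)` is a proper pair of `E`: a pair of `A` with `a + ℕF ⊆ std(E)`. -/
def ProperPair {d : ℕ} (A E : Set (Fin d → ℤ)) (a : Fin d → ℤ)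
    (F : Set (Fin d → ℤ)) : Prop :=
  a ∈ NSemi A ∧ IsFace A F ∧ cell a F ⊆ stdSet A E

/-- `(a,F)` is a standard pair of `E`: a proper pair of `E` maximal with respect to
the partial order `(a,F) ≼ (b,G) ↔ a + ℕF ⊆ b + ℕG`. -/
def StdPair {d : ℕ} (A E : Set (Fin d → ℤ)) (a : Fin d → ℤ)
    (F : Set (Fin d → ℤ)) : Prop :=
  ProperPair A E a F ∧
    ∀ b G, ProperPair A E b G → cell a F ⊆ cell b G → cell b G ⊆ cell a F

/-- The overlap class of the standard pair `(a,F)` of `E` is maximal with respect to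
divisibility among overlap classes of standard pairs of `E`. -/
def MaxClass {d : ℕ} (A E : Set (Fin d → ℤ)) (a : Fin d → ℤ)
    (F : Set (Fin d → ℤ)) : Prop :=
  ∀ b G, StdPair A E b G → PairDvd A a F b G → PairDvd A b G a F

noncomputable section

/-- The affine semigroup ring `k[ℕA]`. -/
abbrev SGRing {d : ℕ} (k : Type*) [Field k] (A : Set (Fin d → ℤ)) :=
  AddMonoidAlgebra k (NSemi A)

/-- The monomial `t^a` of `k[ℕA]`. -/
def mono {d : ℕ} (k : Type*) [Field k] (A : Set (Fin d → ℤ)) (a : (NSemi A)) :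
    SGRing k A :=
  AddMonoidAlgebra.single a 1

/-- `I` is a monomial ideal of `k[ℕA]`: an ideal generated by monomials. -/
def IsMonomialIdeal {d : ℕ} (k : Type*) [Field k] (A : Set (Fin d → ℤ))
    (I : Ideal (SGRing k A)) : Prop :=
  ∃ S : Set (NSemi A), I = Ideal.span ((fun a => mono k A a) '' S)

/-- The exponent set `E(I) = {a ∈ ℕA : t^a ∈ I}` of an ideal of `k[ℕA]`,
as a subset of `ℤ^d`. -/
def expSet {d : ℕ} (k : Type*) [Field k] (A : Set (Fin d → ℤ))
    (I : Ideal (SGRing k A)) : Set (Fin d → ℤ) :=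
  {x | ∃ h : x ∈ NSemi A, mono k A ⟨x, h⟩ ∈ I}

/-- The monomial prime ideal `p_F = ⟨t^a : a ∈ ℕA ∖ ℕF⟩` of `k[ℕA]`. -/
def primeF {d : ℕ} (k : Type*) [Field k] (A F : Set (Fin d → ℤ)) :
    Ideal (SGRing k A) :=
  Ideal.span {x | ∃ a : (NSemi A), (a : Fin d → ℤ) ∉ NSemi F ∧ x = mono k A a}

end

/-- The elements of `A` dividing some multiple of `s` in `ℕA`: the smallest face of `A` whose
semigroup contains `s`. -/
def faceOf {d : ℕ} (A : Set (Fin d → ℤ)) (s : Fin d → ℤ) : Set (Fin d → ℤ) :=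
  {g | g ∈ A ∧ ∃ N : ℕ, N • s - g ∈ NSemi A}

/-- Simultaneous Diophantine approximation of nonnegative reals by natural numbers. -/
theorem exists_nat_simultaneous_approx {ι : Type*} [Fintype ι] (c : ι → ℝ) (hc : ∀ i, 0 ≤ c i)
    {ε : ℝ} (hε : 0 < ε) :
    ∃ q : ℕ, 0 < q ∧ ∃ p : ι → ℕ, ∀ i, |q * c i - p i| < ε := by
  have hx : ∀ n : ℕ, (fun i => Int.fract (n * c i)) ∈ Set.Icc (0 : ι → ℝ) 1 := fun n =>
    ⟨fun i => Int.fract_nonneg _, fun i => (Int.fract_lt_one _).le⟩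
  obtain ⟨a, -, φ, hφ, hlim⟩ := tendsto_subseq_of_bounded (Metric.isBounded_Icc _ _) hx
  obtain ⟨N, hN⟩ := Metric.cauchySeq_iff'.1 hlim.cauchySeq ε hε
  have h := hN (N + 1) (Nat.le_succ N)
  have hlt : φ N < φ (N + 1) := hφ (Nat.lt_succ_self N)
  refine ⟨φ (N + 1) - φ N, Nat.sub_pos_of_lt hlt,
    fun i => (⌊(φ (N + 1) : ℝ) * c i⌋ - ⌊(φ N : ℝ) * c i⌋).toNat, fun i => ?_⟩
  have hle : ⌊(φ N : ℝ) * c i⌋ ≤ ⌊(φ (N + 1) : ℝ) * c i⌋ := by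
    gcongr
    exact hc i
  have hcast : (((⌊(φ (N + 1) : ℝ) * c i⌋ - ⌊(φ N : ℝ) * c i⌋).toNat : ℕ) : ℝ)
      = ⌊(φ (N + 1) : ℝ) * c i⌋ - ⌊(φ N : ℝ) * c i⌋ := by
    have := Int.toNat_of_nonneg (sub_nonneg.2 hle)
    exact_mod_cast this
  rw [hcast, Nat.cast_sub hlt.le]
  have hi := lt_of_le_of_lt (dist_le_pi_dist _ _ i) h
  rw [Real.dist_eq] at hi
  simp only [Function.comp_apply, Int.fract] at hi
  refine lt_of_eq_of_lt (congrArg abs ?_) hi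
  ring

/-- A nonnegative real linear relation among lattice points can be replaced by one with
natural number coefficients that is positive at a given index where the real coefficient is. -/
theorem exists_nat_relation {d : ℕ} {ι : Type*} [Fintype ι] (w : ι → Fin d → ℤ) (c : ι → ℝ)
    (hc : ∀ i, 0 ≤ c i) (h : ∑ i, c i • toR (w i) = 0) (j : ι) (hj : 0 < c j) :
    ∃ p : ι → ℕ, ∑ i, p i • w i = 0 ∧ 0 < p j := by
  set B : ℝ := ∑ k, ∑ i, |(w i k : ℝ)|
  have hB0 : 0 ≤ B := by positivity
  obtain ⟨q, hq, p, hp⟩ := exists_nat_simultaneous_approx c hc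
    (ε := min (c j) (1 / (B + 1))) (by positivity)
  refine ⟨p, ?_, ?_⟩
  · ext k
    have h0 : ∑ i, c i * (w i k : ℝ) = 0 := by
      have := congrFun h k
      simpa [toR, Finset.sum_apply] using this
    have hk : ∑ i, |(w i k : ℝ)| ≤ B :=
      Finset.single_le_sum (f := fun k => ∑ i, |(w i k : ℝ)|)
        (fun k _ => by positivity) (Finset.mem_univ k)
    have habs : |∑ i, (p i : ℝ) * (w i k : ℝ)| < 1 := by
      have heq : ∑ i, (p i : ℝ) * (w i k : ℝ) = ∑ i, -((q * c i - p i) * (w i k : ℝ)) := by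
        have : ∑ i, -((q * c i - p i) * (w i k : ℝ))
            = ∑ i, (p i : ℝ) * (w i k : ℝ) - q * ∑ i, c i * (w i k : ℝ) := by
          rw [Finset.mul_sum, ← Finset.sum_sub_distrib]
          exact Finset.sum_congr rfl fun i _ => by ring
        rw [this, h0]
        ring
      calc |∑ i, (p i : ℝ) * (w i k : ℝ)|
          ≤ ∑ i, |-((q * c i - p i) * (w i k : ℝ))| := heq ▸ Finset.abs_sum_le_sum_abs _ _
        _ ≤ ∑ i, 1 / (B + 1) * |(w i k : ℝ)| := by
          refine Finset.sum_le_sum fun i _ => ?_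
          rw [abs_neg, abs_mul]
          gcongr
          exact (hp i).le.trans (min_le_right _ _)
        _ ≤ 1 / (B + 1) * B := by
          rw [← Finset.mul_sum]
          gcongr
        _ < 1 := by
          rw [one_div_mul_eq_div, div_lt_one (by positivity)]
          linarith
    have hlt_one : |∑ i, (p i : ℤ) * w i k| < 1 := by exact_mod_cast habs
    simpa [Finset.sum_apply] using Int.abs_lt_one_iff.1 hlt_one
  · by_contra h0
    have hj' := (hp j).trans_le (min_le_left _ _)
    have hq' : (1 : ℝ) ≤ q := by exact_mod_cast hq
    rw [Nat.eq_zero_of_not_pos h0, Nat.cast_zero, sub_zero, abs_of_nonneg (by positivity)] at hj'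
    nlinarith

section Cone

variable {d : ℕ} {A S T : Set (Fin d → ℤ)}

theorem toR_add (x y : Fin d → ℤ) : toR (x + y) = toR x + toR y := by
  ext i
  simp [toR]

theorem toR_sub (x y : Fin d → ℤ) : toR (x - y) = toR x - toR y := by
  ext i
  simp [toR]

theorem toR_nsmul (n : ℕ) (x : Fin d → ℤ) : toR (n • x) = (n : ℝ) • toR x := by
  ext i
  simp [toR]

theorem toR_injective : Function.Injective (toR : (Fin d → ℤ) → Fin d → ℝ) := fun x y h => by
  ext i
  have := congrFun h i
  simpa [toR] using this

theorem cone_mono (h : S ⊆ T) : cone S ⊆ cone T := by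
  rintro x ⟨t, c, ht, hc, rfl⟩
  exact ⟨t, c, ht.trans h, hc, rfl⟩

theorem zero_mem_cone : (0 : Fin d → ℝ) ∈ cone S :=
  ⟨∅, 0, by simp, fun _ => le_rfl, by simp⟩

theorem smul_mem_cone {x : Fin d → ℝ} (hx : x ∈ cone S) {r : ℝ} (hr : 0 ≤ r) :
    r • x ∈ cone S := by
  obtain ⟨t, c, ht, hc, rfl⟩ := hx
  exact ⟨t, fun v => r * c v, ht, fun v => mul_nonneg hr (hc v), by
    simp [Finset.smul_sum, mul_smul]⟩

theorem add_mem_cone {x y : Fin d → ℝ} (hx : x ∈ cone S) (hy : y ∈ cone S) :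
    x + y ∈ cone S := by
  classical
  obtain ⟨t, c, ht, hc, rfl⟩ := hx
  obtain ⟨u, e, hu, he, rfl⟩ := hy
  refine ⟨t ∪ u, fun v => (if v ∈ t then c v else 0) + (if v ∈ u then e v else 0),
    by simpa using ⟨ht, hu⟩, fun v => ?_, ?_⟩
  · have := hc v
    have := he v
    positivity
  · simp only [add_smul, ite_smul, zero_smul, Finset.sum_add_distrib, Finset.sum_ite_mem]
    rw [Finset.inter_eq_right.2 Finset.subset_union_left,
      Finset.inter_eq_right.2 Finset.subset_union_right]

theorem sum_mem_cone {ι : Type*} (t : Finset ι) (f : ι → Fin d → ℝ)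
    (h : ∀ i ∈ t, f i ∈ cone S) : ∑ i ∈ t, f i ∈ cone S :=
  Finset.sum_induction f (· ∈ cone S) (fun _ _ => add_mem_cone) zero_mem_cone h

theorem toR_mem_cone {v : Fin d → ℤ} (hv : v ∈ S) : toR v ∈ cone S :=
  ⟨{v}, fun _ => 1, by simpa using hv, fun _ => zero_le_one, by simp⟩

theorem toR_mem_cone_of_mem_NSemi {v : Fin d → ℤ} (hv : v ∈ NSemi S) : toR v ∈ cone S := by
  induction hv using AddSubmonoid.closure_induction with
  | mem x hx => exact toR_mem_cone hx
  | zero =>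
    convert zero_mem_cone
    ext i
    simp [toR]
  | add x y _ _ hx hy => exact toR_add x y ▸ add_mem_cone hx hy

theorem mem_NSemi_faceOf {s h : Fin d → ℤ} {N : ℕ} (hh : h ∈ NSemi A)
    (hs : N • s - h ∈ NSemi A) : h ∈ NSemi (faceOf A s) := by
  induction hh using AddSubmonoid.closure_induction with
  | mem x hx => exact AddSubmonoid.subset_closure ⟨hx, N, hs⟩
  | zero => exact zero_mem _
  | add x y hx hy ihx ihy =>
    refine add_mem (ihx ?_) (ihy ?_)
    · convert add_mem hs hy using 1
      abel
    · convert add_mem hs hx using 1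
      abel

theorem exists_nsmul_sub_mem_NSemi_faceOf {s f : Fin d → ℤ} (hf : f ∈ NSemi (faceOf A s)) :
    ∃ N : ℕ, N • s - f ∈ NSemi (faceOf A s) := by
  have hfA : f ∈ NSemi A := AddSubmonoid.closure_mono (fun _ h => h.1) hf
  obtain ⟨N, hN⟩ : ∃ N : ℕ, N • s - f ∈ NSemi A := by
    clear hfA
    induction hf using AddSubmonoid.closure_induction with
    | mem x hx => exact hx.2
    | zero => exact ⟨0, by simp⟩
    | add x y _ _ ihx ihy =>
      obtain ⟨N, hN⟩ := ihx
      obtain ⟨M, hM⟩ := ihy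
      refine ⟨N + M, ?_⟩
      convert add_mem hN hM using 1
      rw [add_smul]
      abel
  exact ⟨N, mem_NSemi_faceOf (N := N) hN (by simpa using hfA)⟩

theorem exists_smul_sub_mem_cone {s : Fin d → ℤ} {z : Fin d → ℝ} (hz : z ∈ cone (faceOf A s)) :
    ∃ K : ℝ, 0 ≤ K ∧ K • toR s - z ∈ cone A := by
  obtain ⟨t, c, ht, hc, rfl⟩ := hz
  choose! N hN using fun v (hv : v ∈ faceOf A s) => hv.2
  refine ⟨∑ v ∈ t, c v * N v, Finset.sum_nonneg fun v _ => mul_nonneg (hc v) (by positivity), ?_⟩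
  rw [Finset.sum_smul, ← Finset.sum_sub_distrib]
  refine sum_mem_cone _ _ fun v hv => ?_
  have := smul_mem_cone (toR_mem_cone_of_mem_NSemi (hN v (ht hv))) (hc v)
  rwa [toR_sub, toR_nsmul, smul_sub, smul_smul] at this

theorem mem_faceOf_of_smul_sub_smul_mem_cone {s a : Fin d → ℤ} (ha : a ∈ A) {K c : ℝ}
    (hK : 0 ≤ K) (hc : 0 < c) (h : K • toR s - c • toR a ∈ cone A) : a ∈ faceOf A s := by
  obtain ⟨t, e, ht, he, hsum⟩ := h
  let w : Option (Option t) → Fin d → ℤ := fun o => o.elim (-s) fun o => o.elim a Subtype.val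
  let r : Option (Option t) → ℝ := fun o => o.elim K fun o => o.elim c fun v => e v
  have hr : ∀ i, 0 ≤ r i := by
    rintro (_ | _ | v)
    exacts [hK, hc.le, he v]
  have hneg : toR (-s) = -toR s := by
    ext i
    simp [toR]
  have hrel : ∑ i, r i • toR (w i) = 0 := by
    simp only [Fintype.sum_option, r, w, Option.elim]
    rw [Finset.sum_coe_sort t (fun v => e v • toR v), ← hsum, hneg, smul_neg]
    abel
  obtain ⟨p, hp, hpos⟩ := exists_nat_relation w r hr hrel (some none) hc
  simp only [Fintype.sum_option, w, Option.elim] at hp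
  obtain ⟨m, hm⟩ := Nat.exists_eq_add_of_lt hpos
  rw [hm] at hp
  have haA : a ∈ NSemi A := AddSubmonoid.subset_closure ha
  refine ⟨ha, p none, ?_⟩
  have hmem : m • a + ∑ v : t, p (some (some v)) • (v : Fin d → ℤ) ∈ NSemi A :=
    add_mem (nsmul_mem haA _) <| sum_mem fun v _ =>
      nsmul_mem (AddSubmonoid.subset_closure (ht v.2)) _
  convert hmem using 1
  rw [zero_add, add_smul, one_smul, smul_neg] at hp
  rw [← sub_eq_zero, ← neg_eq_zero, ← hp]
  abel

theorem isFace_faceOf (A : Set (Fin d → ℤ)) (s : Fin d → ℤ) : IsFace A (faceOf A s) := by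
  classical
  have hsub : faceOf A s ⊆ A := fun _ h => h.1
  refine ⟨hsub, ⟨cone_mono hsub, ?_⟩, Set.Subset.antisymm ?_ ?_⟩
  · rintro x ⟨t, e, ht, he, rfl⟩ y hy z hz ⟨α, β, hα, hβ, -, rfl⟩
    obtain ⟨K, hK, hKz⟩ := exists_smul_sub_mem_cone hz
    refine sum_mem_cone _ _ fun v hv => ?_
    rcases (he v).eq_or_lt with h0 | hpos
    · simpa [← h0] using zero_mem_cone
    refine smul_mem_cone (toR_mem_cone ?_) hpos.le
    refine mem_faceOf_of_smul_sub_smul_mem_cone (ht hv) hK (mul_pos hα hpos) ?_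
    have hrest : α • ∑ u ∈ t.erase v, e u • toR u ∈ cone A :=
      smul_mem_cone (sum_mem_cone _ _ fun u hu =>
        smul_mem_cone (toR_mem_cone (ht (Finset.mem_of_mem_erase hu))) (he u)) hα.le
    convert add_mem_cone (add_mem_cone hKz (smul_mem_cone hy hβ.le)) hrest using 1
    rw [← Finset.add_sum_erase t _ hv, smul_add, mul_smul]
    abel
  · rintro _ ⟨hx, a, ha, rfl⟩
    obtain ⟨K, hK, hKa⟩ := exists_smul_sub_mem_cone hx
    exact ⟨a, mem_faceOf_of_smul_sub_smul_mem_cone ha hK one_pos (by rwa [one_smul]), rfl⟩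
  · rintro _ ⟨a, ha, rfl⟩
    exact ⟨toR_mem_cone ha, a, ha.1, rfl⟩

theorem faceOf_subset {G : Set (Fin d → ℤ)} (hG : IsFace A G) {s : Fin d → ℤ}
    (hs : s ∈ NSemi G) : faceOf A s ⊆ G := by
  rintro g ⟨hg, N, hN⟩
  have hz : (2⁻¹ : ℝ) • toR (N • s) ∈ cone G :=
    smul_mem_cone (toR_mem_cone_of_mem_NSemi (nsmul_mem hs N)) (by norm_num)
  have hgG : toR g ∈ cone G :=
    hG.2.1.left_mem_of_mem_openSegment (toR_mem_cone hg) (toR_mem_cone_of_mem_NSemi hN) hz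
      ⟨2⁻¹, 2⁻¹, by norm_num, by norm_num, by norm_num, by
        rw [← smul_add, ← toR_add, add_sub_cancel]⟩
  obtain ⟨g', hg', he⟩ := hG.2.2.subset ⟨hgG, g, hg, rfl⟩
  exact toR_injective he ▸ hg'

end Cone

/-- If `G ⊆ G'` and the translate of `a + ℕP`, `P ⊆ ℕG` finite, by `b` avoids `b' + ℕG'`, then
it lies in the cell of a pair, contained in `b + ℕG`, that avoids `b' + ℕG'` as well. -/
theorem exists_pair_of_linear_subset {d : ℕ} {A : Set (Fin d → ℤ)} {b b' : Fin d → ℤ}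
    {G G' : Set (Fin d → ℤ)} (hG : IsFace A G) (hGG' : G ⊆ G') (a : NSemi G)
    {P : Set (NSemi G)} (hP : P.Finite)
    (hav : ∀ m ∈ AddSubmonoid.closure P, b + (a + m : NSemi G) ∉ cell b' G') :
    ∃ p : (Fin d → ℤ) × Set (Fin d → ℤ), (p.1 ∈ cell b G ∧ IsFace A p.2 ∧ p.2 ⊆ G) ∧
      (∀ m ∈ AddSubmonoid.closure P, b + (a + m : NSemi G) ∈ cell p.1 p.2) ∧
      cell p.1 p.2 ⊆ cell b G \ cell b' G' := by
  classical
  lift P to Finset (NSemi G) using hP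
  set s : NSemi G := ∑ v ∈ P, v with hs
  have hsP : s ∈ AddSubmonoid.closure (P : Set (NSemi G)) :=
    sum_mem fun v hv => AddSubmonoid.subset_closure hv
  have hGA : NSemi G ≤ NSemi A := AddSubmonoid.closure_mono hG.1
  have hFG : faceOf A (s : Fin d → ℤ) ⊆ G := faceOf_subset hG s.2
  refine ⟨(b + a, faceOf A s), ⟨⟨a, a.2, rfl⟩, isFace_faceOf A s, hFG⟩, fun m hm => ?_, ?_⟩
  · have hle : AddSubmonoid.closure (P : Set (NSemi G)) ≤
        (NSemi (faceOf A s)).comap (NSemi G).subtype := by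
      refine (AddSubmonoid.closure_le).2 fun v hv => ?_
      refine mem_NSemi_faceOf (N := 1) (hGA v.2) ?_
      have hsv : (s : Fin d → ℤ) = v + (∑ u ∈ P.erase v, u : NSemi G) := by
        rw [hs, ← Finset.add_sum_erase P _ hv]
        rfl
      rw [one_smul, hsv]
      simpa using hGA (∑ u ∈ P.erase v, u : NSemi G).2
    exact ⟨m, hle hm, by simp [add_assoc]⟩
  · rintro _ ⟨f, hf, rfl⟩
    refine ⟨⟨a + f, add_mem a.2 (AddSubmonoid.closure_mono hFG hf), by simp [add_assoc]⟩, ?_⟩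
    rintro ⟨g, hg, he⟩
    obtain ⟨N, hN⟩ := exists_nsmul_sub_mem_NSemi_faceOf hf
    refine hav (N • s) (nsmul_mem hsP N)
      ⟨g + (N • (s : Fin d → ℤ) - f),
        add_mem hg (AddSubmonoid.closure_mono (hFG.trans hGG') hN), ?_⟩
    rw [← add_assoc, ← show b + a + f = b' + g from he]
    push_cast
    abel

/-- For `b, b' ∈ ℕA` and faces `G ⊆ G'` of `A` there is a finite
set `C` of pairs `(a,F)` with `a ∈ b + ℕG` and `F` a face of `A` contained in `G`,
such that `(b + ℕG) ∖ (b' + ℕG') = ⋃_{(a,F) ∈ C} (a + ℕF)`. -/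
theorem pair_difference_decomposition {d : ℕ} (A : Set (Fin d → ℤ)) (hA : IsConfig A)
    (b b' : Fin d → ℤ) (hb : b ∈ NSemi A) (hb' : b' ∈ NSemi A)
    (G G' : Set (Fin d → ℤ)) (hG : IsFace A G) (hG' : IsFace A G') (hGG' : G ⊆ G') :
    ∃ C : Set ((Fin d → ℤ) × Set (Fin d → ℤ)), C.Finite ∧
      (∀ p ∈ C, p.1 ∈ cell b G ∧ IsFace A p.2 ∧ p.2 ⊆ G) ∧
      cell b G \ cell b' G' = ⋃ p ∈ C, cell p.1 p.2 := by
  have hGfin : G.Finite := hA.finite.subset hG.1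
  have hG'fin : G'.Finite := hA.finite.subset hG'.1
  have : AddMonoid.FG (NSemi G) :=
    (AddMonoid.fg_iff_addSubmonoid_fg _).2 ((AddSubmonoid.fg_iff _).2 ⟨G, rfl, hGfin⟩)
  have hsemi : IsSemilinearSet {m : NSemi G | b + (m : Fin d → ℤ) ∈ cell b' G'} := by
    have h := ((IsSemilinearSet.closure_of_finite hG'fin).vadd (b' - b)).preimage
      (NSemi G).subtype
    convert h using 1
    ext m
    simp only [Set.mem_ofPred_eq, Set.mem_preimage, Set.mem_vadd_set, cell, vadd_eq_add]
    refine exists_congr fun f => and_congr Iff.rfl ?_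
    rw [AddSubmonoid.subtype_apply, sub_add_eq_add_sub, sub_eq_iff_eq_add, eq_comm,
      add_comm b]
  obtain ⟨S, hS, hlin, hU⟩ := hsemi.compl
  have hpair : ∀ t ∈ S, ∃ p : (Fin d → ℤ) × Set (Fin d → ℤ),
      (p.1 ∈ cell b G ∧ IsFace A p.2 ∧ p.2 ⊆ G) ∧
      (∀ m ∈ t, b + (m : Fin d → ℤ) ∈ cell p.1 p.2) ∧
      cell p.1 p.2 ⊆ cell b G \ cell b' G' := by
    intro t ht
    have hav : ∀ m ∈ t, b + (m : Fin d → ℤ) ∉ cell b' G' := fun m hm =>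
      hU.symm.subset (Set.mem_sUnion_of_mem hm ht)
    obtain ⟨a, P, hP, rfl⟩ := hlin t ht
    obtain ⟨p, hp, hcov, hsub⟩ := exists_pair_of_linear_subset hG hGG' a hP fun m hm =>
      hav (a + m) (Set.vadd_mem_vadd_set hm)
    refine ⟨p, hp, ?_, hsub⟩
    rintro _ ⟨m, hm, rfl⟩
    exact hcov m hm
  choose! f hf hcov hsub using hpair
  refine ⟨f '' S, hS.image f, ?_, Set.Subset.antisymm ?_ ?_⟩
  · rintro _ ⟨t, ht, rfl⟩
    exact hf t ht
  · rintro _ ⟨⟨g, hg, rfl⟩, hx⟩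
    obtain ⟨t, ht, hgt⟩ := hU.subset (show (⟨g, hg⟩ : NSemi G) ∈ _ from hx)
    exact Set.mem_biUnion (Set.mem_image_of_mem f ht) (hcov t ht ⟨g, hg⟩ hgt)
  · refine Set.iUnion₂_subset ?_
    rintro _ ⟨t, ht, rfl⟩
    exact hsub t ht

end StdPairsPaper
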